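/- Let F : ℝ^N → ℝ, A a real r×N matrix, b ∈ ℝ^r, L(x, λ) := F(x) + ⟪λ, A x − b⟫, and let α, s, ξ, θ, ρ with ρ ≠ 0, t > 0 be real numbers. Let x, u, w, ζ ∈ ℝ^N and λ, μ, λ* ∈ ℝ^r, let x* ∈ ℝ^N satisfy A x* = b, and suppose the flow relations 2 w + (α/t) u + ζ + Aᵀλ = 0 and (ρ/t) μ = A(x + u) − b hold. Then the formal Lyapunov derivative D := t·(L(x, λ*) − L(x*, λ)) + (t²/2)⟪ζ + Aᵀλ*, u⟫ + ⟪(s+1)u + t w, s(x − x*) + t u⟫ + ξ⟪u, x − x*⟫ + 2θ⟪μ, λ − λ*⟫ satisfies the identity D = t·(L(x, λ*) − L(x*, λ)) + t(s + 1 − α/2)‖u‖² − (s t/2)⟪ζ + Aᵀλ, x − x*⟫ + (s(s+1) + ξ − sα/2)⟪u, x − x*⟫ + (2 t θ/ρ)⟪A x − b, λ − λ*⟫ + (2 t θ/ρ − t²/2)⟪A u, λ − λ*⟫. -/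

import Mathlib

open scoped RealInnerProductSpace

/-- Term-by-term rewriting of the formal Lyapunov derivative along the
accelerated primal-dual flow. -/
theorem lyapunov_derivative_identity {N r : ℕ} (F : EuclideanSpace ℝ (Fin N) → ℝ)
    (A : EuclideanSpace ℝ (Fin N) →L[ℝ] EuclideanSpace ℝ (Fin r))
    (b : EuclideanSpace ℝ (Fin r))
    (L : EuclideanSpace ℝ (Fin N) → EuclideanSpace ℝ (Fin r) → ℝ)
    (hL : ∀ x lam, L x lam = F x + ⟪lam, A x - b⟫)
    (α s ξ θ ρ t : ℝ) (hρ : ρ ≠ 0) (ht : 0 < t)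
    (x u w ζ : EuclideanSpace ℝ (Fin N)) (lam μ lamstar : EuclideanSpace ℝ (Fin r))
    (xstar : EuclideanSpace ℝ (Fin N)) (hxstar : A xstar = b)
    (hflow₁ : (2 : ℝ) • w + (α / t) • u + ζ + (ContinuousLinearMap.adjoint A) lam = 0)
    (hflow₂ : (ρ / t) • μ = A (x + u) - b) :
    t * (L x lamstar - L xstar lam)
        + (t ^ 2 / 2) * ⟪ζ + (ContinuousLinearMap.adjoint A) lamstar, u⟫
        + ⟪(s + 1) • u + t • w, s • (x - xstar) + t • u⟫
        + ξ * ⟪u, x - xstar⟫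
        + 2 * θ * ⟪μ, lam - lamstar⟫
      = t * (L x lamstar - L xstar lam)
        + t * (s + 1 - α / 2) * ‖u‖ ^ 2
        - (s * t / 2) * ⟪ζ + (ContinuousLinearMap.adjoint A) lam, x - xstar⟫
        + (s * (s + 1) + ξ - s * α / 2) * ⟪u, x - xstar⟫
        + (2 * t * θ / ρ) * ⟪A x - b, lam - lamstar⟫
        + (2 * t * θ / ρ - t ^ 2 / 2) * ⟪A u, lam - lamstar⟫ := by
  have hw : w = (-(1 / 2 : ℝ)) • ((α / t) • u + (ζ + (ContinuousLinearMap.adjoint A) lam)) := by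
    have h : (2 : ℝ) • w = -((α / t) • u + (ζ + (ContinuousLinearMap.adjoint A) lam)) := by
      rw [eq_neg_iff_add_eq_zero, ← hflow₁]
      abel
    rw [neg_smul, ← smul_neg, ← h, smul_smul]
    norm_num
  have hμ : μ = (t / ρ) • ((A x - b) + A u) := by
    have h : (A x - b) + A u = (ρ / t) • μ := by
      rw [hflow₂, map_add]
      abel
    rw [h, smul_smul, div_mul_div_cancel₀ hρ, div_self ht.ne', one_smul]
  have hdual : ⟪ζ + (ContinuousLinearMap.adjoint A) lamstar, u⟫
      = ⟪ζ + (ContinuousLinearMap.adjoint A) lam, u⟫ - ⟪A u, lam - lamstar⟫ := by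
    rw [inner_add_left, inner_add_left, ContinuousLinearMap.adjoint_inner_left,
      ContinuousLinearMap.adjoint_inner_left, inner_sub_right, real_inner_comm lam,
      real_inner_comm lamstar]
    ring
  rw [hdual, hw, hμ]
  generalize ζ + (ContinuousLinearMap.adjoint A) lam = g
  generalize x - xstar = d
  generalize A x - b = c
  generalize lam - lamstar = e
  simp only [inner_add_left, inner_add_right, real_inner_smul_left,
    real_inner_smul_right, real_inner_self_eq_norm_sq]
  field_simp
  ring
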